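/- arXiv:1812.08844 — 5 statements merged into one kernel-verified Lean document; each statement's English description precedes it below -/
import Mathlib

section
/- The inclusion ι : E₁ → E is a compact operator: the image under ι of every bounded subset of E₁ is relatively compact in E. (This is the implication (2) ⇒ (3) in the characterization of unbounded self-adjoint operators with purely discrete spectrum.) -/
open Filter Topology Bornology
open scoped RealInnerProductSpace

namespace HilbertBasis

variable {ι E F : Type*} [NormedAddCommGroup E] [InnerProductSpace ℝ E]

theorem norm_le_norm_of_abs_repr_le (e : HilbertBasis ι ℝ E) {x y : E}
    (h : ∀ i, |e.repr x i| ≤ |e.repr y i|) : ‖x‖ ≤ ‖y‖ := by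
  rw [← e.repr.norm_map x, ← e.repr.norm_map y]
  exact lp.norm_mono (by norm_num) h

theorem repr_tsum_smul (e : HilbertBasis ι ℝ E) {a : ι → ℝ}
    (ha : Summable fun i => a i ^ 2) (i : ι) : e.repr (∑' j, a j • e j) i = a i := by
  have hmem : Memℓp a 2 := memℓp_gen (by simpa using ha)
  have hsum := (e.hasSum_repr_symm ⟨a, hmem⟩).tsum_eq
  rw [hsum, LinearIsometryEquiv.apply_symm_apply]

variable [SeminormedAddCommGroup F] [NormedSpace ℝ F]

/-- The composition of `f` with the orthogonal projection onto the span of `e i`, `i ∈ s`. -/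
noncomputable def truncate (e : HilbertBasis ι ℝ E) (f : F →L[ℝ] E) (s : Finset ι) : F →L[ℝ] E :=
  ∑ i ∈ s, ((innerSL ℝ (e i)).comp f).smulRight (e i)

theorem isCompactOperator_truncate (e : HilbertBasis ι ℝ E) (f : F →L[ℝ] E) (s : Finset ι) :
    IsCompactOperator (e.truncate f s) := by
  refine (compactOperator (RingHom.id ℝ) F E).sum_mem fun i _ => ?_
  exact (isCompactOperator_id (E := ℝ)).comp_clm ((innerSL ℝ (e i)).comp f) |>.clm_comp
    (ContinuousLinearMap.toSpanSingleton ℝ (e i))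

theorem repr_truncate [DecidableEq ι] (e : HilbertBasis ι ℝ E) (f : F →L[ℝ] E) (s : Finset ι)
    (x : F) (i : ι) : e.repr (e.truncate f s x) i = if i ∈ s then e.repr (f x) i else 0 := by
  simp only [truncate, e.repr_apply_apply]
  simp [inner_sum, inner_smul_right, orthonormal_iff_ite.mp e.orthonormal]

/-- An operator whose coordinates, weighted by coefficients tending to infinity, are those of a
bounded map is compact. -/
theorem isCompactOperator_of_repr_eq_mul [CompleteSpace E] (e : HilbertBasis ℕ ℝ E) {lam : ℕ → ℝ}
    (hlam : Tendsto (fun n => |lam n|) atTop atTop) (f : F →L[ℝ] E) (g : F → E)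
    (hg : ∀ x, ‖g x‖ ≤ ‖x‖) (hfg : ∀ x n, e.repr (g x) n = lam n * e.repr (f x) n) :
    IsCompactOperator f := by
  refine isCompactOperator_of_tendsto (l := atTop)
    (F := fun N => e.truncate f (Finset.range N)) ?_
    (Eventually.of_forall fun N => e.isCompactOperator_truncate f _)
  rw [Metric.tendsto_atTop]
  intro ε hε
  obtain ⟨N, hN⟩ := eventually_atTop.mp (hlam.eventually_ge_atTop (ε / 2)⁻¹)
  refine ⟨N, fun M hM => ?_⟩
  rw [dist_eq_norm]
  refine (ContinuousLinearMap.opNorm_le_bound _ (half_pos hε).le fun x => ?_).trans_lt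
    (half_lt_self hε)
  calc ‖(e.truncate f (Finset.range M) - f) x‖ ≤ ‖(ε / 2) • g x‖ := by
        refine e.norm_le_norm_of_abs_repr_le fun n => ?_
        simp only [sub_apply, map_sub, map_smul, lp.coeFn_sub, lp.coeFn_smul, Pi.sub_apply,
          Pi.smul_apply, smul_eq_mul, repr_truncate, Finset.mem_range, hfg]
        split_ifs with hn
        · simpa only [sub_self, abs_zero] using abs_nonneg _
        · have h1 : 1 ≤ ε / 2 * |lam n| := by
            have := hN n (by omega)
            rwa [inv_le_iff_one_le_mul₀' (half_pos hε)] at this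
          rw [zero_sub, abs_neg, ← mul_assoc, abs_mul, abs_mul, abs_of_pos (half_pos hε)]
          exact le_mul_of_one_le_left (abs_nonneg _) h1
    _ ≤ ε / 2 * ‖x‖ := by
        rw [norm_smul, Real.norm_of_nonneg (half_pos hε).le]
        gcongr
        exact hg x

end HilbertBasis

/-- In the setting of an unbounded self-adjoint operator
`A x = ∑' n, λ n ⟪x, e n⟫ • e n` with purely discrete spectrum (`|λ n| → ∞`),
with `E₁` the domain `D = {x | ∑ λ n ^ 2 ⟪x, e n⟫ ^ 2 < ∞}` equipped with the graph
inner product `⟪x,y⟫₁ = ⟪x,y⟫ + ⟪Ax,Ay⟫`, the inclusion `ι : E₁ → E` is a compact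
operator: the image of every bounded subset of `E₁` is relatively compact in `E`. -/
theorem stmt_0
    {E : Type*} [NormedAddCommGroup E] [InnerProductSpace ℝ E] [CompleteSpace E]
    (e : HilbertBasis ℕ ℝ E) (lam : ℕ → ℝ)
    (hlam : Tendsto (fun n => |lam n|) atTop atTop)
    {E₁ : Type*} [NormedAddCommGroup E₁] [InnerProductSpace ℝ E₁] [CompleteSpace E₁]
    (ι : E₁ →ₗ[ℝ] E) (hι : Function.Injective ι)
    (hrange : Set.range ι = {x : E | Summable fun n => lam n ^ 2 * e.repr x n ^ 2})
    (A : E₁ → E)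
    (hA : ∀ x : E₁, A x = ∑' (n : ℕ), (lam n * e.repr (ι x) n) • e n)
    (hgraph : ∀ x y : E₁, ⟪x, y⟫ = ⟪ι x, ι y⟫ + ⟪A x, A y⟫) :
    ∀ s : Set E₁, IsBounded s → IsCompact (closure (ι '' s)) := by
  have hnorm (x : E₁) : ‖x‖ ^ 2 = ‖ι x‖ ^ 2 + ‖A x‖ ^ 2 := by
    simpa only [real_inner_self_eq_norm_sq] using hgraph x x
  have hι_le (x : E₁) : ‖ι x‖ ≤ 1 * ‖x‖ := by
    rw [one_mul]
    exact (sq_le_sq₀ (norm_nonneg _) (norm_nonneg _)).1 (by nlinarith [hnorm x, sq_nonneg ‖A x‖])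
  have hA_le (x : E₁) : ‖A x‖ ≤ ‖x‖ :=
    (sq_le_sq₀ (norm_nonneg _) (norm_nonneg _)).1 (by nlinarith [hnorm x, sq_nonneg ‖ι x‖])
  have hrepr (x : E₁) (n : ℕ) : e.repr (A x) n = lam n * e.repr (ι x) n := by
    have hx : Summable fun n => lam n ^ 2 * e.repr (ι x) n ^ 2 :=
      hrange.subset (Set.mem_range_self x)
    rw [hA, e.repr_tsum_smul (by simpa only [mul_pow] using hx)]
  have hcompact : IsCompactOperator ι :=
    e.isCompactOperator_of_repr_eq_mul hlam (ι.mkContinuous 1 hι_le) A hA_le hrepr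
  exact fun s hs => hcompact.isCompact_closure_image_of_bounded hs
end

section
/- Let U be an open bounded subset of E₁ with f⁻¹(0) ⊆ U and cl U ⊆ D_f (closure in E₁). Then there exists ε > 0 such that ‖f(x)‖ ≥ 2ε for every x in the boundary ∂U of U in E₁. -/
open Filter Topology Bornology
open scoped RealInnerProductSpace

/-- Coordinatewise domination in a Hilbert basis implies domination of norms. -/
theorem HilbertBasis.norm_le_mul_of_repr_le {E : Type*} [NormedAddCommGroup E]
    [InnerProductSpace ℝ E] (e : HilbertBasis ℕ ℝ E) {z w : E} {c : ℝ} (hc : 0 ≤ c)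
    (h : ∀ n, |e.repr z n| ≤ c * |e.repr w n|) : ‖z‖ ≤ c * ‖w‖ := by
  have hsum (v : E) : HasSum (fun n => e.repr v n ^ 2) (‖v‖ ^ 2) := by
    have := lp.hasSum_norm (p := 2) (by simp) (e.repr v)
    simpa [LinearIsometryEquiv.norm_map] using this
  refine le_of_sq_le_sq ?_ (by positivity)
  rw [mul_pow]
  refine hasSum_le (fun n => ?_) (hsum z) ((hsum w).mul_left (c ^ 2))
  rw [← sq_abs, ← sq_abs (e.repr w n), ← mul_pow]
  exact pow_le_pow_left₀ (abs_nonneg _) (h n) 2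

/-- A bounded operator `J` is compact if its composition with a diagonal operator, whose entries
tend to infinity in absolute value, is a bounded operator `T`. -/
theorem HilbertBasis.isCompactOperator_of_repr_eq {E E₁ : Type*} [NormedAddCommGroup E]
    [InnerProductSpace ℝ E] [CompleteSpace E] [NormedAddCommGroup E₁] [InnerProductSpace ℝ E₁]
    (e : HilbertBasis ℕ ℝ E) {lam : ℕ → ℝ} (hlam : Tendsto (fun n => |lam n|) atTop atTop)
    (J T : E₁ →L[ℝ] E) (h : ∀ x n, e.repr (T x) n = lam n * e.repr (J x) n) :
    IsCompactOperator J := by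
  classical
  let P : ℕ → E₁ →L[ℝ] E := fun N =>
    ∑ i ∈ Finset.range N, ((innerSL ℝ (e i)).comp J).smulRight (e i)
  have hP (N : ℕ) (x : E₁) (n : ℕ) :
      e.repr (P N x) n = if n < N then e.repr (J x) n else 0 := by
    have : P N x = ∑ i ∈ Finset.range N, e.repr (J x) i • e i := by
      simp [P, HilbertBasis.repr_apply_apply]
    rw [this, HilbertBasis.repr_apply_apply, inner_sum]
    simp [inner_smul_right, orthonormal_iff_ite.mp e.orthonormal]
  refine isCompactOperator_of_tendsto (F := P) (l := atTop) ?_ (Eventually.of_forall fun N => ?_)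
  · rw [tendsto_iff_norm_sub_tendsto_zero, Metric.tendsto_atTop]
    intro δ hδ
    set c : ℝ := δ / (2 * (‖T‖ + 1)) with hc
    have hc0 : 0 < c := by positivity
    obtain ⟨N₀, hN₀⟩ := eventually_atTop.mp (hlam.eventually_ge_atTop c⁻¹)
    refine ⟨N₀, fun N hN => ?_⟩
    have hb : ‖P N - J‖ ≤ c * ‖T‖ := by
      refine ContinuousLinearMap.opNorm_le_bound _ (by positivity) fun x => ?_
      have : ‖(P N - J) x‖ ≤ c * ‖T x‖ := by
        refine e.norm_le_mul_of_repr_le hc0.le fun n => ?_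
        have hr : e.repr ((P N - J) x) n = e.repr (P N x) n - e.repr (J x) n := by simp
        rw [hr, hP, h]
        split_ifs with hn
        · simp only [sub_self, abs_zero]; positivity
        · have h1 : 1 ≤ c * |lam n| := by
            have := mul_le_mul_of_nonneg_left (hN₀ n (by omega)) hc0.le
            rwa [mul_inv_cancel₀ hc0.ne'] at this
          rw [zero_sub, abs_neg, abs_mul, ← mul_assoc]
          exact le_mul_of_one_le_left (abs_nonneg _) h1
      calc ‖(P N - J) x‖ ≤ c * ‖T x‖ := this
        _ ≤ c * (‖T‖ * ‖x‖) := by gcongr; exact T.le_opNorm x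
        _ = c * ‖T‖ * ‖x‖ := by ring
    have hlt : c * ‖T‖ < δ := by
      rw [hc, div_mul_eq_mul_div, div_lt_iff₀ (by positivity)]
      nlinarith [norm_nonneg T]
    simpa using hb.trans_lt hlt
  · refine Submodule.sum_mem (compactOperator (RingHom.id ℝ) E₁ E) fun i _ => ?_
    exact (isCompactOperator_of_locallyCompactSpace_rng
      ((1 : ℝ →L[ℝ] ℝ).smulRight (e i))).comp_clm ((innerSL ℝ (e i)).comp J)

/-- Let `f : D_f → E`, `f x = A x − F (ι x)`, be a local map (with `F`
continuous and `f⁻¹(0)` compact). Let `U` be an open bounded subset of `E₁` with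
`f⁻¹(0) ⊆ U` and `cl U ⊆ D_f`. Then there exists `ε > 0` such that `‖f x‖ ≥ 2ε` for
every `x` in the boundary `∂U` of `U` in `E₁`. -/
theorem stmt_5
    {E : Type*} [NormedAddCommGroup E] [InnerProductSpace ℝ E] [CompleteSpace E]
    (e : HilbertBasis ℕ ℝ E) (lam : ℕ → ℝ)
    (hlam : Tendsto (fun n => |lam n|) atTop atTop)
    {E₁ : Type*} [NormedAddCommGroup E₁] [InnerProductSpace ℝ E₁] [CompleteSpace E₁]
    (ι : E₁ →ₗ[ℝ] E) (hι : Function.Injective ι)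
    (hrange : Set.range ι = {x : E | Summable fun n => lam n ^ 2 * e.repr x n ^ 2})
    (A : E₁ → E)
    (hA : ∀ x : E₁, A x = ∑' (n : ℕ), (lam n * e.repr (ι x) n) • e n)
    (hgraph : ∀ x y : E₁, ⟪x, y⟫ = ⟪ι x, ι y⟫ + ⟪A x, A y⟫)
    (F : E → E) (hF : Continuous F)
    (Df : Set E₁) (hDf : IsOpen Df)
    (hzc : IsCompact {x : E₁ | x ∈ Df ∧ A x - F (ι x) = 0})
    (U : Set E₁) (hUopen : IsOpen U) (hUbdd : IsBounded U)
    (hzU : {x : E₁ | x ∈ Df ∧ A x - F (ι x) = 0} ⊆ U)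
    (hclU : closure U ⊆ Df) :
    ∃ ε > 0, ∀ x ∈ frontier U, 2 * ε ≤ ‖A x - F (ι x)‖ := by
  have hsummable (x : E₁) : Summable fun n => lam n ^ 2 * e.repr (ι x) n ^ 2 := by
    have : ι x ∈ Set.range ι := ⟨x, rfl⟩
    rwa [hrange] at this
  have hrepr (x : E₁) (n : ℕ) : e.repr (A x) n = lam n * e.repr (ι x) n := by
    have hmem : Memℓp (fun n => lam n * e.repr (ι x) n) 2 := by
      refine memℓp_gen ?_
      simpa [mul_pow] using hsummable x
    let w : lp (fun _ : ℕ => ℝ) 2 := ⟨_, hmem⟩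
    have : A x = e.repr.symm w := by
      rw [hA]; exact (e.hasSum_repr_symm w).tsum_eq
    rw [this, LinearIsometryEquiv.apply_symm_apply]
  have hnorm (x : E₁) : ‖x‖ ^ 2 = ‖ι x‖ ^ 2 + ‖A x‖ ^ 2 := by
    simpa using hgraph x x
  let AL : E₁ →ₗ[ℝ] E :=
    { toFun := A
      map_add' := fun x y => e.repr.injective <| by
        ext n
        simp [hrepr, mul_add]
      map_smul' := fun r x => e.repr.injective <| by
        ext n
        simp [hrepr, mul_left_comm] }
  let J : E₁ →L[ℝ] E := ι.mkContinuous 1 fun x => by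
    rw [one_mul]
    exact le_of_sq_le_sq (by nlinarith [hnorm x, sq_nonneg ‖A x‖]) (norm_nonneg _)
  let T : E₁ →L[ℝ] E := AL.mkContinuous 1 fun x => by
    rw [one_mul]
    change ‖A x‖ ≤ ‖x‖
    exact le_of_sq_le_sq (by nlinarith [hnorm x, sq_nonneg ‖ι x‖]) (norm_nonneg _)
  have hJ : IsCompactOperator J := e.isCompactOperator_of_repr_eq hlam J T hrepr
  have hanti : AntilipschitzWith 2 (J.prod T) := by
    refine (J.prod T).antilipschitz_of_bound fun x => ?_
    have h1 : ‖ι x‖ ≤ ‖(J.prod T) x‖ := norm_fst_le ((J.prod T) x)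
    have h2 : ‖A x‖ ≤ ‖(J.prod T) x‖ := norm_snd_le ((J.prod T) x)
    refine le_of_sq_le_sq ?_ (by positivity)
    rw [hnorm, mul_pow]
    have h3 := pow_le_pow_left₀ (norm_nonneg _) h1 2
    have h4 := pow_le_pow_left₀ (norm_nonneg _) h2 2
    have h5 := sq_nonneg ‖(J.prod T) x‖
    rw [NNReal.coe_ofNat]
    linarith
  have hemb : IsClosedEmbedding (J.prod T) :=
    hanti.isClosedEmbedding (J.prod T).uniformContinuous
  by_contra! hcon
  choose u hu hus using fun n : ℕ => hcon (1 / ((n : ℝ) + 1)) (by positivity)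
  have hfu : Tendsto (fun n => T (u n) - F (J (u n))) atTop (𝓝 0) := by
    refine squeeze_zero_norm (fun n => (hus n).le) ?_
    simpa using (tendsto_one_div_add_atTop_nhds_zero_nat (𝕜 := ℝ)).const_mul 2
  obtain ⟨K, hK, hKsub⟩ := hJ.image_subset_compact_of_bounded hUbdd.closure
  obtain ⟨y, -, φ, hφ, hy⟩ := hK.tendsto_subseq
    (fun n => hKsub ⟨u n, frontier_subset_closure (hu n), rfl⟩)
  have hTy : Tendsto (fun n => T (u (φ n))) atTop (𝓝 (F y)) := by
    simpa using (hfu.comp hφ.tendsto_atTop).add ((hF.tendsto y).comp hy)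
  have hlim : Tendsto (fun n => (J.prod T) (u (φ n))) atTop (𝓝 (y, F y)) := hy.prodMk_nhds hTy
  obtain ⟨x, hx⟩ := hemb.isClosed_range.mem_of_tendsto hlim
    (Eventually.of_forall fun n => ⟨_, rfl⟩)
  have hux : Tendsto (fun n => u (φ n)) atTop (𝓝 x) := by
    rw [hemb.isInducing.tendsto_nhds_iff, hx]
    exact hlim
  have hxfr : x ∈ frontier U :=
    isClosed_frontier.mem_of_tendsto hux (Eventually.of_forall fun n => hu (φ n))
  have hιx : ι x = y := congrArg Prod.fst hx
  have hAx : A x = F y := congrArg Prod.snd hx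
  have hxU : x ∈ U := hzU ⟨hclU (frontier_subset_closure hxfr), by rw [hιx, hAx, sub_self]⟩
  rw [hUopen.frontier_eq] at hxfr
  exact hxfr.2 hxU
end

section
/- Define f̃ₙ : D_f → E by f̃ₙ(x) = Ax − PₙF(ιx). Let U be an open bounded subset of E₁ with cl U ⊆ D_f, and let ε > 0. Then there exists N such that for all n ≥ N: (1) ‖f(x) − f̃ₙ(x)‖ < ε for all x ∈ cl U; and (2) if moreover ‖f(x)‖ ≥ 2ε for all x ∈ ∂U, then ‖f̃ₙ(x)‖ > ε for all x ∈ ∂U. -/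
open Filter Topology Bornology
open scoped RealInnerProductSpace

/-- The orthogonal projection `Pₙ : E → Vₙ` onto `Vₙ = span {e k : |λ k| ≤ n}`,
given by `Pₙ x = ∑_{|λ k| ≤ n} ⟪x, e k⟫ e k`. -/
noncomputable def projP {E : Type*} [NormedAddCommGroup E] [InnerProductSpace ℝ E]
    (e : HilbertBasis ℕ ℝ E) (lam : ℕ → ℝ) (n : ℕ) (x : E) : E :=
  ∑' k : {k : ℕ // |lam k| ≤ (n : ℝ)}, e.repr x (k : ℕ) • e (k : ℕ)

/-- Coefficientwise domination in a Hilbert basis implies domination of norms. -/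
theorem HilbertBasis.norm_le_of_abs_repr_le {ι E : Type*} [NormedAddCommGroup E]
    [InnerProductSpace ℝ E] (e : HilbertBasis ι ℝ E) {u v : E}
    (h : ∀ k, |e.repr u k| ≤ |e.repr v k|) : ‖u‖ ≤ ‖v‖ := by
  rw [← e.repr.norm_map u, ← e.repr.norm_map v]
  exact lp.norm_mono (by norm_num) h

theorem HilbertBasis.repr_sub_sum {ι E : Type*} [DecidableEq ι] [NormedAddCommGroup E]
    [InnerProductSpace ℝ E] (e : HilbertBasis ι ℝ E) (S : Finset ι) (x : E) (k : ι) :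
    e.repr (x - ∑ j ∈ S, e.repr x j • e j) k = if k ∈ S then 0 else e.repr x k := by
  have h : e.repr (∑ j ∈ S, e.repr x j • e j) k = if k ∈ S then e.repr x k else 0 := by
    rw [e.repr_apply_apply, inner_sum]
    simp [inner_smul_right, orthonormal_iff_ite.mp e.orthonormal]
  rw [map_sub, lp.coeFn_sub, Pi.sub_apply, h]
  split_ifs <;> simp

theorem HilbertBasis.norm_sub_sum_le {ι E : Type*} [NormedAddCommGroup E]
    [InnerProductSpace ℝ E] (e : HilbertBasis ι ℝ E) (S : Finset ι) (x : E) :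
    ‖x - ∑ j ∈ S, e.repr x j • e j‖ ≤ ‖x‖ := by
  classical
  refine e.norm_le_of_abs_repr_le fun k => ?_
  rw [e.repr_sub_sum]
  split_ifs <;> simp

/-- Partial sums along an exhausting family of finite sets converge uniformly on totally bounded
sets. -/
theorem HilbertBasis.eventually_norm_sub_sum_lt {ι E : Type*} [NormedAddCommGroup E]
    [InnerProductSpace ℝ E] (e : HilbertBasis ι ℝ E) {S : ℕ → Finset ι}
    (hS : Tendsto S atTop atTop) {K : Set E} (hK : TotallyBounded K) {ε : ℝ} (hε : 0 < ε) :
    ∀ᶠ n in atTop, ∀ y ∈ K, ‖y - ∑ j ∈ S n, e.repr y j • e j‖ < ε := by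
  obtain ⟨t, ht, hKt⟩ := Metric.totallyBounded_iff.mp hK (ε / 2) (half_pos hε)
  have hev : ∀ᶠ n in atTop, ∀ z ∈ t, ‖z - ∑ j ∈ S n, e.repr z j • e j‖ < ε / 2 := by
    rw [Filter.eventually_all_finite ht]
    intro z _
    have h := (tendsto_const_nhds (x := z)).sub ((e.hasSum_repr z).comp hS)
    rw [sub_self] at h
    simpa using h.norm.eventually_lt_const (by simpa using half_pos hε)
  filter_upwards [hev] with n hn y hy
  obtain ⟨z, hz, hyz⟩ := Set.mem_iUnion₂.mp (hKt hy)
  rw [Metric.mem_ball, dist_eq_norm] at hyz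
  have hsplit : y - ∑ j ∈ S n, e.repr y j • e j =
      ((y - z) - ∑ j ∈ S n, e.repr (y - z) j • e j) + (z - ∑ j ∈ S n, e.repr z j • e j) := by
    simp only [map_sub, lp.coeFn_sub, Pi.sub_apply, sub_smul, Finset.sum_sub_distrib]
    abel
  rw [hsplit]
  linarith [norm_add_le ((y - z) - ∑ j ∈ S n, e.repr (y - z) j • e j)
    (z - ∑ j ∈ S n, e.repr z j • e j), e.norm_sub_sum_le (S n) (y - z), hn z hz]

/-- A bounded set which is uniformly approximated by finite partial sums in a Hilbert basis is
totally bounded. -/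
theorem HilbertBasis.totallyBounded_of_norm_sub_sum_lt {ι E : Type*} [NormedAddCommGroup E]
    [InnerProductSpace ℝ E] (e : HilbertBasis ι ℝ E) {T : Set E} {R : ℝ}
    (hR : ∀ x ∈ T, ‖x‖ ≤ R)
    (hT : ∀ δ > 0, ∃ S : Finset ι, ∀ x ∈ T, ‖x - ∑ j ∈ S, e.repr x j • e j‖ < δ) :
    TotallyBounded T := by
  refine Metric.totallyBounded_iff.mpr fun δ hδ => ?_
  obtain ⟨S, hS⟩ := hT (δ / 2) (half_pos hδ)
  have hc : IsCompact ((fun a : ι → ℝ => ∑ j ∈ S, a j • e j) ''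
      Set.pi Set.univ fun _ => Set.Icc (-R) R) :=
    (isCompact_univ_pi fun _ => isCompact_Icc).image (by fun_prop)
  obtain ⟨t, ht, hct⟩ := Metric.totallyBounded_iff.mp hc.totallyBounded (δ / 2) (half_pos hδ)
  refine ⟨t, ht, fun x hx => ?_⟩
  have hmem : ∑ j ∈ S, e.repr x j • e j ∈ (fun a : ι → ℝ => ∑ j ∈ S, a j • e j) ''
      Set.pi Set.univ fun _ => Set.Icc (-R) R := by
    refine ⟨fun j => e.repr x j, fun j _ => abs_le.mp ?_, rfl⟩
    have h := lp.norm_apply_le_norm (by norm_num) (e.repr x) j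
    rw [e.repr.norm_map] at h
    exact h.trans (hR x hx)
  obtain ⟨z, hz, hxz⟩ := Set.mem_iUnion₂.mp (hct hmem)
  refine Set.mem_iUnion₂.mpr ⟨z, hz, ?_⟩
  have h := hS x hx
  rw [← dist_eq_norm] at h
  rw [Metric.mem_ball] at hxz ⊢
  linarith [dist_triangle x (∑ j ∈ S, e.repr x j • e j) z]

/-- The coefficients of a diagonal series are the prescribed ones. -/
theorem HilbertBasis.repr_tsum_smul_s6 {ι E : Type*} [NormedAddCommGroup E]
    [InnerProductSpace ℝ E] (e : HilbertBasis ι ℝ E) {c : ι → ℝ}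
    (hc : Summable fun k => c k ^ 2) (k : ι) : e.repr (∑' j, c j • e j) k = c k := by
  have hmem : Memℓp c 2 := by
    refine memℓp_gen ?_
    simpa using hc
  have h := (e.hasSum_repr_symm ⟨c, hmem⟩).tsum_eq
  change ∑' j, c j • e j = _ at h
  rw [h, LinearIsometryEquiv.apply_symm_apply]

/-- Define `f̃ₙ : D_f → E` by `f̃ₙ x = A x − Pₙ F (ι x)`. Let `U` be an
open bounded subset of `E₁` with `cl U ⊆ D_f`, and let `ε > 0`. Then there is `N` such
that for all `n ≥ N`: (1) `‖f x − f̃ₙ x‖ < ε` for all `x ∈ cl U`; and (2) if moreover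
`‖f x‖ ≥ 2ε` for all `x ∈ ∂U`, then `‖f̃ₙ x‖ > ε` for all `x ∈ ∂U`. -/
theorem stmt_6
    {E : Type*} [NormedAddCommGroup E] [InnerProductSpace ℝ E] [CompleteSpace E]
    (e : HilbertBasis ℕ ℝ E) (lam : ℕ → ℝ)
    (hlam : Tendsto (fun n => |lam n|) atTop atTop)
    {E₁ : Type*} [NormedAddCommGroup E₁] [InnerProductSpace ℝ E₁] [CompleteSpace E₁]
    (ι : E₁ →ₗ[ℝ] E) (hι : Function.Injective ι)
    (hrange : Set.range ι = {x : E | Summable fun n => lam n ^ 2 * e.repr x n ^ 2})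
    (A : E₁ → E)
    (hA : ∀ x : E₁, A x = ∑' (n : ℕ), (lam n * e.repr (ι x) n) • e n)
    (hgraph : ∀ x y : E₁, ⟪x, y⟫ = ⟪ι x, ι y⟫ + ⟪A x, A y⟫)
    (F : E → E) (hF : Continuous F)
    (Df : Set E₁) (hDf : IsOpen Df)
    (hzc : IsCompact {x : E₁ | x ∈ Df ∧ A x - F (ι x) = 0})
    (U : Set E₁) (hUopen : IsOpen U) (hUbdd : IsBounded U)
    (hclU : closure U ⊆ Df)
    (ε : ℝ) (hε : 0 < ε) :
    ∃ N : ℕ, ∀ n ≥ N,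
      (∀ x ∈ closure U,
        ‖(A x - F (ι x)) - (A x - projP e lam n (F (ι x)))‖ < ε) ∧
      ((∀ x ∈ frontier U, 2 * ε ≤ ‖A x - F (ι x)‖) →
        ∀ x ∈ frontier U, ε < ‖A x - projP e lam n (F (ι x))‖) := by
  classical
  have hfin : ∀ n : ℕ, {k : ℕ | |lam k| ≤ (n : ℝ)}.Finite := fun n => by
    have h := hlam.eventually_gt_atTop (n : ℝ)
    rw [← Nat.cofinite_eq_atTop, Filter.eventually_cofinite] at h
    simpa using h
  set S : ℕ → Finset ℕ := fun n => (hfin n).toFinset with hSdef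
  have hmemS : ∀ n k, k ∈ S n ↔ |lam k| ≤ (n : ℝ) := fun n k => by simp [hSdef]
  have hproj : ∀ n y, projP e lam n y = ∑ j ∈ S n, e.repr y j • e j := fun n y => by
    have h := (S n).tsum_subtype' fun j => e.repr y j • e j
    rwa [(hfin n).coe_toFinset] at h
  have hStend : Tendsto S atTop atTop := by
    refine tendsto_atTop_finset_of_monotone (fun m n hmn k hk => ?_) fun k => ?_
    · rw [hmemS] at hk ⊢
      exact hk.trans (by exact_mod_cast hmn)
    · obtain ⟨n, hn⟩ := exists_nat_ge |lam k|
      exact ⟨n, (hmemS n k).mpr hn⟩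
  obtain ⟨R, hR⟩ := hUbdd.closure.exists_norm_le
  have hnorm : ∀ x, ‖x‖ ^ 2 = ‖ι x‖ ^ 2 + ‖A x‖ ^ 2 := fun x => by
    simpa only [real_inner_self_eq_norm_sq] using hgraph x x
  have hιR : ∀ x ∈ closure U, ‖ι x‖ ≤ R := fun x hx =>
    (pow_le_pow_iff_left₀ (norm_nonneg _) (norm_nonneg _) two_ne_zero |>.mp (by linarith [hnorm x, sq_nonneg ‖A x‖])).trans (hR x hx)
  have hAR : ∀ x ∈ closure U, ‖A x‖ ≤ R := fun x hx =>
    (pow_le_pow_iff_left₀ (norm_nonneg _) (norm_nonneg _) two_ne_zero |>.mp (by linarith [hnorm x, sq_nonneg ‖ι x‖])).trans (hR x hx)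
  have hreprA : ∀ x k, e.repr (A x) k = lam k * e.repr (ι x) k := fun x k => by
    have hs : ι x ∈ {x : E | Summable fun n => lam n ^ 2 * e.repr x n ^ 2} :=
      hrange ▸ Set.mem_range_self x
    rw [hA]
    exact e.repr_tsum_smul_s6 (c := fun k => lam k * e.repr (ι x) k)
      (by simpa only [mul_pow, Set.mem_ofPred_eq] using hs) k
  have htail : ∀ (n : ℕ) x,
      (n : ℝ) * ‖ι x - ∑ j ∈ S n, e.repr (ι x) j • e j‖ ≤ ‖A x‖ := fun n x => by
    have h : ‖(n : ℝ) • (ι x - ∑ j ∈ S n, e.repr (ι x) j • e j)‖ ≤ ‖A x‖ := by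
      refine e.norm_le_of_abs_repr_le fun k => ?_
      rw [map_smul, lp.coeFn_smul, Pi.smul_apply, e.repr_sub_sum, hreprA, smul_eq_mul, abs_mul,
        abs_mul, Nat.abs_cast]
      split_ifs with hk
      · rw [abs_zero, mul_zero]
        positivity
      · rw [hmemS, not_le] at hk
        gcongr
    rwa [norm_smul, Real.norm_natCast] at h
  have hT : TotallyBounded (ι '' closure U) := by
    refine e.totallyBounded_of_norm_sub_sum_lt (Set.forall_mem_image.mpr hιR) fun δ hδ => ?_
    obtain ⟨n, hn⟩ := exists_nat_gt (R / δ)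
    refine ⟨S n, Set.forall_mem_image.mpr fun x hx => ?_⟩
    rw [div_lt_iff₀ hδ] at hn
    exact lt_of_mul_lt_mul_left (((htail n x).trans (hAR x hx)).trans_lt hn) n.cast_nonneg
  have hK : TotallyBounded (F '' closure (ι '' closure U)) :=
    ((hT.closure.isCompact_of_isClosed isClosed_closure).image hF).totallyBounded
  obtain ⟨N, hN⟩ := eventually_atTop.mp (e.eventually_norm_sub_sum_lt hStend hK hε)
  have key : ∀ n ≥ N, ∀ x ∈ closure U,
      ‖(A x - F (ι x)) - (A x - projP e lam n (F (ι x)))‖ < ε := fun n hn x hx => by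
    rw [sub_sub_sub_cancel_left, norm_sub_rev, hproj]
    exact hN n hn _ (Set.mem_image_of_mem F (subset_closure (Set.mem_image_of_mem ι hx)))
  refine ⟨N, fun n hn => ⟨key n hn, fun hfr x hx => ?_⟩⟩
  linarith [hfr x hx, key n hn x (frontier_subset_closure hx),
    norm_sub_norm_le (A x - F (ι x)) (A x - projP e lam n (F (ι x)))]
end

section
/- Let U be an open bounded subset of E₁ with cl U ⊆ D_f. Suppose ε > 0 satisfies ‖f(x)‖ ≥ 2ε for all x ∈ ∂U, and n ∈ ℕ satisfies ‖f(x) − (Ax − PₙF(ιx))‖ < ε for all x ∈ cl U. Then the zero set of the finite-dimensional approximation fₙ : U ∩ Vₙ → Vₙ, fₙ(x) = Ax − PₙF(x), namely {x ∈ U ∩ Vₙ : Ax = PₙF(x)}, is compact. -/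
open Filter Topology Bornology
open scoped RealInnerProductSpace

/-- The finite-dimensional subspace `Vₙ = span {e k : |λ k| ≤ n}` of `E`. -/
def spanV {E : Type*} [NormedAddCommGroup E] [InnerProductSpace ℝ E]
    (e : HilbertBasis ℕ ℝ E) (lam : ℕ → ℝ) (n : ℕ) : Submodule ℝ E :=
  Submodule.span ℝ ((fun k => e k) '' {k : ℕ | |lam k| ≤ (n : ℝ)})

theorem finite_setOf_abs_le {lam : ℕ → ℝ} (hlam : Tendsto (fun n => |lam n|) atTop atTop)
    (c : ℝ) : {k : ℕ | |lam k| ≤ c}.Finite := by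
  have h := hlam.eventually (eventually_gt_atTop c)
  rw [← Nat.cofinite_eq_atTop, eventually_cofinite] at h
  simpa using h

theorem continuous_projP {E : Type*} [NormedAddCommGroup E] [InnerProductSpace ℝ E]
    (e : HilbertBasis ℕ ℝ E) {lam : ℕ → ℝ} {n : ℕ}
    (hfin : {k : ℕ | |lam k| ≤ (n : ℝ)}.Finite) : Continuous (projP e lam n) := by
  have : Fintype {k : ℕ // |lam k| ≤ (n : ℝ)} := hfin.fintype
  unfold projP
  simp only [tsum_fintype, HilbertBasis.repr_apply_apply]
  fun_prop

theorem finiteDimensional_spanV {E : Type*} [NormedAddCommGroup E] [InnerProductSpace ℝ E]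
    (e : HilbertBasis ℕ ℝ E) {lam : ℕ → ℝ} {n : ℕ}
    (hfin : {k : ℕ | |lam k| ≤ (n : ℝ)}.Finite) : FiniteDimensional ℝ (spanV e lam n) :=
  FiniteDimensional.span_of_finite ℝ (hfin.image _)

section GraphInnerProduct

variable {E E₁ : Type*} [NormedAddCommGroup E] [InnerProductSpace ℝ E]
  [NormedAddCommGroup E₁] [InnerProductSpace ℝ E₁]

/-- A pair of maps whose inner products add up to that of the source is isometric in the
Hilbert-sum sense, even without assuming linearity. -/
theorem norm_sub_sq_add_norm_sub_sq_of_inner_eq {f g : E₁ → E}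
    (h : ∀ x y : E₁, ⟪x, y⟫ = ⟪f x, f y⟫ + ⟪g x, g y⟫) (x y : E₁) :
    ‖f x - f y‖ ^ 2 + ‖g x - g y‖ ^ 2 = ‖x - y‖ ^ 2 := by
  rw [norm_sub_sq_real, norm_sub_sq_real, norm_sub_sq_real]
  simp only [← real_inner_self_eq_norm_sq]
  linarith [h x x, h x y, h y y]

theorem continuous_left_of_inner_eq {f g : E₁ → E}
    (h : ∀ x y : E₁, ⟪x, y⟫ = ⟪f x, f y⟫ + ⟪g x, g y⟫) : Continuous f := by
  refine (LipschitzWith.of_dist_le_mul (K := 1) fun x y => ?_).continuous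
  rw [dist_eq_norm, dist_eq_norm, NNReal.coe_one, one_mul]
  refine le_of_sq_le_sq ?_ (norm_nonneg _)
  nlinarith [norm_sub_sq_add_norm_sub_sq_of_inner_eq h x y, sq_nonneg ‖g x - g y‖]

theorem continuous_right_of_inner_eq {f g : E₁ → E}
    (h : ∀ x y : E₁, ⟪x, y⟫ = ⟪f x, f y⟫ + ⟪g x, g y⟫) : Continuous g :=
  continuous_left_of_inner_eq (g := f) fun x y => (h x y).trans (add_comm _ _)

end GraphInnerProduct

/-- A closed bounded subset of a finite-dimensional subspace is compact. -/
theorem IsCompact.of_isClosed_isBounded_subset_submodule {E : Type*} [NormedAddCommGroup E]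
    [NormedSpace ℝ E] {W : Submodule ℝ E} [FiniteDimensional ℝ W] {s : Set E}
    (hs : IsClosed s) (hb : IsBounded s) (hsW : s ⊆ W) : IsCompact s := by
  have : ProperSpace W := FiniteDimensional.proper_real W
  have hpre : IsCompact ((↑) ⁻¹' s : Set W) :=
    Metric.isCompact_of_isClosed_isBounded (hs.preimage continuous_subtype_val)
      (isometry_subtype_coe.antilipschitz.isBounded_preimage hb)
  rw [← Set.image_preimage_eq_of_subset (hsW.trans Subtype.range_coe.ge)]
  exact hpre.image continuous_subtype_val

/-- Let `U` be open bounded in `E₁` with `cl U ⊆ D_f`. Suppose `ε > 0`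
satisfies `‖f x‖ ≥ 2ε` on `∂U` and `n` satisfies `‖f x − (A x − Pₙ F (ι x))‖ < ε` on
`cl U`. Then the zero set `{x ∈ U ∩ Vₙ : A x = Pₙ F x}` of the finite-dimensional
approximation `fₙ : U ∩ Vₙ → Vₙ` is compact. -/
theorem stmt_7
    {E : Type*} [NormedAddCommGroup E] [InnerProductSpace ℝ E] [CompleteSpace E]
    (e : HilbertBasis ℕ ℝ E) (lam : ℕ → ℝ)
    (hlam : Tendsto (fun n => |lam n|) atTop atTop)
    {E₁ : Type*} [NormedAddCommGroup E₁] [InnerProductSpace ℝ E₁] [CompleteSpace E₁]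
    (ι : E₁ →ₗ[ℝ] E) (hι : Function.Injective ι)
    (hrange : Set.range ι = {x : E | Summable fun n => lam n ^ 2 * e.repr x n ^ 2})
    (A : E₁ → E)
    (hA : ∀ x : E₁, A x = ∑' (n : ℕ), (lam n * e.repr (ι x) n) • e n)
    (hgraph : ∀ x y : E₁, ⟪x, y⟫ = ⟪ι x, ι y⟫ + ⟪A x, A y⟫)
    (F : E → E) (hF : Continuous F)
    (Df : Set E₁) (hDf : IsOpen Df)
    (hzc : IsCompact {x : E₁ | x ∈ Df ∧ A x - F (ι x) = 0})
    (U : Set E₁) (hUopen : IsOpen U) (hUbdd : IsBounded U)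
    (hclU : closure U ⊆ Df)
    (ε : ℝ) (hε : 0 < ε)
    (hfront : ∀ x ∈ frontier U, 2 * ε ≤ ‖A x - F (ι x)‖)
    (n : ℕ)
    (hn : ∀ x ∈ closure U,
      ‖(A x - F (ι x)) - (A x - projP e lam n (F (ι x)))‖ < ε) :
    IsCompact {x : E₁ | x ∈ U ∧ ι x ∈ spanV e lam n ∧
      A x = projP e lam n (F (ι x))} := by
  have hfin := finite_setOf_abs_le hlam (n : ℝ)
  have hιc : Continuous ι := continuous_left_of_inner_eq hgraph
  have hAc : Continuous A := continuous_right_of_inner_eq hgraph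
  have hVfin := finiteDimensional_spanV e hfin
  have hWfin : FiniteDimensional ℝ ((spanV e lam n).comap ι) :=
    Module.Finite.of_injective (ι.submoduleComap (spanV e lam n)) fun x y hxy =>
      Subtype.ext (hι (congrArg Subtype.val hxy))
  have hset : {x : E₁ | x ∈ U ∧ ι x ∈ spanV e lam n ∧ A x = projP e lam n (F (ι x))} =
      closure U ∩ ({x | ι x ∈ spanV e lam n} ∩ {x | A x = projP e lam n (F (ι x))}) := by
    ext x
    refine ⟨fun ⟨hxU, hx⟩ => ⟨subset_closure hxU, hx⟩, fun ⟨hxU, hx⟩ => ⟨?_, hx⟩⟩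
    by_contra hxn
    have hlow := hfront x (hUopen.frontier_eq ▸ ⟨hxU, hxn⟩)
    have hup := hn x hxU
    rw [sub_eq_zero.mpr hx.2, sub_zero] at hup
    linarith
  rw [hset]
  refine IsCompact.of_isClosed_isBounded_subset_submodule (W := (spanV e lam n).comap ι)
    (isClosed_closure.inter (IsClosed.inter ?_ ?_))
    (hUbdd.closure.subset Set.inter_subset_left) fun x hx => hx.2.1
  · exact (spanV e lam n).closed_of_finiteDimensional.preimage hιc
  · exact isClosed_eq hAc ((continuous_projP e hfin).comp (hF.comp hιc))
end

section
/- Let H be a real Hilbert space, (Wₙ)_{n∈ℕ} an increasing sequence of closed subspaces of H whose union is dense in H, and Qₙ : H → Wₙ the orthogonal projections. Let K ⊆ H be compact and U ⊆ H open and bounded with K ⊆ U. Then there exist an open set W and N ∈ ℕ such that K ⊆ W ⊆ U and Qₙ(cl W) ⊆ U for all n ≥ N. -/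
open Filter Topology Bornology
open scoped RealInnerProductSpace

/-- Let `H` be a real Hilbert space, `(Wₙ)` an increasing sequence of
closed subspaces with dense union, and `Qₙ : H → Wₙ` the orthogonal (nearest-point)
projections. Let `K ⊆ H` be compact and `U ⊆ H` open and bounded with `K ⊆ U`. Then
there exist an open set `W` and `N ∈ ℕ` with `K ⊆ W ⊆ U` and `Qₙ(cl W) ⊆ U` for all
`n ≥ N`. -/
theorem stmt_10
    {H : Type*} [NormedAddCommGroup H] [InnerProductSpace ℝ H] [CompleteSpace H]
    (W : ℕ → Submodule ℝ H)
    (hWclosed : ∀ n, IsClosed (W n : Set H))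
    (hWmono : Monotone W)
    (hWdense : Dense (⋃ n, (W n : Set H)))
    (Q : ℕ → H → H)
    (hQmem : ∀ n x, Q n x ∈ W n)
    (hQnear : ∀ n x, ∀ y ∈ W n, ‖x - Q n x‖ ≤ ‖x - y‖)
    (K : Set H) (hK : IsCompact K)
    (U : Set H) (hUopen : IsOpen U) (hUbdd : IsBounded U) (hKU : K ⊆ U) :
    ∃ (V : Set H) (N : ℕ), IsOpen V ∧ K ⊆ V ∧ V ⊆ U ∧
      ∀ n ≥ N, Q n '' closure V ⊆ U := by
  obtain ⟨δ, hδ, hδU⟩ := hK.exists_thickening_subset_open hUopen hKU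
  obtain ⟨N, hN⟩ := hK.elim_directed_cover
    (fun n => Metric.thickening (δ / 6) (W n : Set H)) (fun _ => Metric.isOpen_thickening)
    (fun x _ => by
      obtain ⟨y, hy, hxy⟩ := hWdense.exists_dist_lt x (show 0 < δ / 6 by positivity)
      obtain ⟨n, hn⟩ := Set.mem_iUnion.1 hy
      exact Set.mem_iUnion.2 ⟨n, Metric.mem_thickening_iff.2 ⟨y, hn, hxy⟩⟩)
    (Monotone.directed_le fun _ _ h => Metric.thickening_subset_of_subset _ (hWmono h))
  refine ⟨Metric.thickening (δ / 4) K, N, Metric.isOpen_thickening,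
    Metric.self_subset_thickening (by positivity) K,
    (Metric.thickening_mono (by linarith) K).trans hδU, ?_⟩
  rintro n hn _ ⟨x, hx, rfl⟩
  have hx' : x ∈ Metric.thickening (δ / 3) K :=
    Metric.cthickening_subset_thickening' (by positivity) (by linarith) K
      (Metric.closure_thickening_subset_cthickening (δ / 4) K hx)
  obtain ⟨k, hk, hxk⟩ := Metric.mem_thickening_iff.1 hx'
  obtain ⟨w, hw, hkw⟩ := Metric.mem_thickening_iff.1 (hN hk)
  have hnear := hQnear n x w (hWmono hn hw)
  rw [← dist_eq_norm, ← dist_eq_norm] at hnear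
  refine hδU (Metric.mem_thickening_iff.2 ⟨k, hk, ?_⟩)
  have h₁ := dist_triangle x k w
  have h₂ := dist_triangle_left (Q n x) k x
  linarith
end
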